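/- Let G₄ be the 6×6 matrix (1/2)·[2,1,1,0,1,1; 1,2,1,1,0,1; 1,1,2,1,1,2; 0,1,1,2,1,1; 1,0,1,1,2,1; 1,1,2,1,1,2]. Then ∑_{N₁,...,N₆≥0} q^{NᵀG₄N - (N₁+N₃+N₄+N₆)} / ∏_i (q²;q²)_{N_i} = 6 (q³;q³)_∞³ / ((q;q)_∞ (q²;q²)_∞²). -/

import Mathlib

open scoped BigOperators

/-- Finite q-Pochhammer symbol $(a;q)_n$. -/
noncomputable def qPoch (q a : ℂ) (n : ℕ) : ℂ := ∏ j ∈ Finset.range n, (1 - a * q ^ j)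

/-- Infinite q-Pochhammer symbol $(a;q)_\infty$. -/
noncomputable def qPochInf (q a : ℂ) : ℂ := ∏' j : ℕ, (1 - a * q ^ j)

/-- The quadratic form $N^T G_4 N$ for the $6\times 6$ matrix
$G_4=\frac12\begin{pmatrix}2&1&1&0&1&1\\1&2&1&1&0&1\\1&1&2&1&1&2\\0&1&1&2&1&1\\1&0&1&1&2&1\\1&1&2&1&1&2\end{pmatrix}$. -/
def Q4 (n₁ n₂ n₃ n₄ n₅ n₆ : ℕ) : ℕ :=
  n₁ ^ 2 + n₂ ^ 2 + n₃ ^ 2 + n₄ ^ 2 + n₅ ^ 2 + n₆ ^ 2 +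
    n₁ * n₂ + n₁ * n₃ + n₁ * n₅ + n₁ * n₆ +
    n₂ * n₃ + n₂ * n₄ + n₂ * n₆ +
    n₃ * n₄ + n₃ * n₅ + 2 * (n₃ * n₆) +
    n₄ * n₅ + n₄ * n₆ + n₅ * n₆

open Filter Topology

/-! ### `q`-Pochhammer symbols -/

lemma qPoch_succ (q a : ℂ) (n : ℕ) : qPoch q a (n + 1) = qPoch q a n * (1 - a * q ^ n) :=
  Finset.prod_range_succ _ _

lemma one_sub_pow_succ_ne_zero {p : ℂ} (hp : ‖p‖ < 1) (n : ℕ) : 1 - p ^ (n + 1) ≠ 0 := by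
  intro h
  have h1 : ‖p ^ (n + 1)‖ = 1 := by rw [← sub_eq_zero.mp h, norm_one]
  rw [norm_pow] at h1
  exact (pow_lt_one₀ (norm_nonneg p) hp n.succ_ne_zero).ne h1

lemma qPoch_self_succ (p : ℂ) (n : ℕ) :
    qPoch p p (n + 1) = qPoch p p n * (1 - p ^ (n + 1)) := by
  rw [qPoch_succ, pow_succ']

lemma qPoch_self_ne_zero {p : ℂ} (hp : ‖p‖ < 1) (n : ℕ) : qPoch p p n ≠ 0 := by
  induction n with
  | zero => simp [qPoch]
  | succ n ih =>
    rw [qPoch_self_succ]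
    exact mul_ne_zero ih (one_sub_pow_succ_ne_zero hp n)

lemma summable_norm_mul_pow {p : ℂ} (hp : ‖p‖ < 1) (a : ℂ) :
    Summable fun j : ℕ => ‖-(a * p ^ j)‖ := by
  simp only [norm_neg, norm_mul, norm_pow]
  exact (summable_geometric_of_lt_one (norm_nonneg p) hp).mul_left _

lemma tendsto_qPoch {p : ℂ} (hp : ‖p‖ < 1) (a : ℂ) :
    Tendsto (qPoch p a) atTop (𝓝 (qPochInf p a)) := by
  have h := multipliable_one_add_of_summable (summable_norm_mul_pow hp a)
  simp only [← sub_eq_add_neg] at h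
  exact h.hasProd.tendsto_prod_nat

lemma qPochInf_self_ne_zero {p : ℂ} (hp : ‖p‖ < 1) : qPochInf p p ≠ 0 := by
  have h := tprod_one_add_ne_zero_of_summable (f := fun j : ℕ => -(p * p ^ j))
    (fun j => by
      rw [← sub_eq_add_neg, ← pow_succ']
      exact one_sub_pow_succ_ne_zero hp j)
    (summable_norm_mul_pow hp p)
  simp only [← sub_eq_add_neg] at h
  exact h

lemma exists_norm_inv_qPoch_le {p : ℂ} (hp : ‖p‖ < 1) :
    ∃ K : ℝ, 0 < K ∧ ∀ n, ‖(qPoch p p n)⁻¹‖ ≤ K := by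
  have h := (tendsto_qPoch hp p).inv₀ (qPochInf_self_ne_zero hp)
  obtain ⟨K, hK⟩ := h.norm.bddAbove_range
  refine ⟨max K 1, by positivity, fun n => (hK ⟨n, rfl⟩).trans (le_max_left _ _)⟩

lemma qPochInf_eq_one_sub_mul {p : ℂ} (hp : ‖p‖ < 1) (a : ℂ) :
    qPochInf p a = (1 - a) * qPochInf p (a * p) := by
  have h1 := (tendsto_qPoch hp a).comp (tendsto_add_atTop_nat 1)
  have h2 := (tendsto_qPoch hp (a * p)).const_mul (1 - a)
  refine tendsto_nhds_unique h1 (h2.congr fun n => ?_)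
  simp only [Function.comp, qPoch]
  rw [Finset.prod_range_succ']
  simp only [pow_zero, mul_one, pow_succ', mul_assoc]
  rw [mul_comm]

lemma qPochInf_trisection {p : ℂ} (hp : ‖p‖ < 1) :
    qPochInf p p = qPochInf (p ^ 3) (p ^ 3) * qPochInf (p ^ 3) p * qPochInf (p ^ 3) (p ^ 2) := by
  have hp3 : ‖p ^ 3‖ < 1 := by
    rw [norm_pow]; exact pow_lt_one₀ (norm_nonneg p) hp (by norm_num)
  have h1 := (tendsto_qPoch hp p).comp (tendsto_id.const_mul_atTop' (show 0 < 3 by norm_num))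
  have h2 := ((tendsto_qPoch hp3 (p ^ 3)).mul (tendsto_qPoch hp3 p)).mul
    (tendsto_qPoch hp3 (p ^ 2))
  refine tendsto_nhds_unique h1 (h2.congr fun n => ?_)
  simp only [Function.comp, id]
  induction n with
  | zero => simp [qPoch]
  | succ n ih =>
    rw [show 3 * (n + 1) = 3 * n + 1 + 1 + 1 by ring]
    simp only [qPoch_succ, ← ih]
    ring

lemma qPochInf_cube {p : ℂ} (hp : ‖p‖ < 1) {w : ℂ} (hw : w ^ 2 + w + 1 = 0) :
    qPochInf p p * qPochInf p (w * p) * qPochInf p (w ^ 2 * p) = qPochInf (p ^ 3) (p ^ 3) := by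
  have hp3 : ‖p ^ 3‖ < 1 := by
    rw [norm_pow]; exact pow_lt_one₀ (norm_nonneg p) hp (by norm_num)
  refine tendsto_nhds_unique (((tendsto_qPoch hp p).mul (tendsto_qPoch hp (w * p))).mul
    (tendsto_qPoch hp (w ^ 2 * p))) ((tendsto_qPoch hp3 (p ^ 3)).congr fun n => ?_)
  simp only [qPoch, ← Finset.prod_mul_distrib]
  refine Finset.prod_congr rfl fun j _ => ?_
  rw [← pow_mul, mul_comm 3 j, pow_mul]
  generalize p ^ j = x
  linear_combination (p * x - p ^ 2 * x ^ 2 * w + p ^ 3 * x ^ 3 * (w - 1)) * hw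

/-! ### The `q`-Vandermonde sum and its limit -/

lemma sum_antidiagonal_qPoch {p : ℂ} (hp : ‖p‖ < 1) (u m : ℕ) :
    ∑ x ∈ Finset.HasAntidiagonal.antidiagonal u,
      p ^ (x.1 * (x.1 + m)) / (qPoch p p x.1 * qPoch p p (x.1 + m) * qPoch p p x.2)
      = 1 / (qPoch p p u * qPoch p p (u + m)) := by
  have h0 := qPoch_self_ne_zero hp
  have h1 := one_sub_pow_succ_ne_zero hp
  induction u generalizing m with
  | zero => simp [qPoch]
  | succ u ih =>
    have hrec : (1 - p ^ (u + 1)) * ∑ x ∈ Finset.HasAntidiagonal.antidiagonal (u + 1),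
        p ^ (x.1 * (x.1 + m)) / (qPoch p p x.1 * qPoch p p (x.1 + m) * qPoch p p x.2)
        = 1 / (qPoch p p u * qPoch p p (u + (m + 1))) := by
      rw [← ih (m + 1), Finset.mul_sum]
      have hsplit : ∀ x ∈ Finset.HasAntidiagonal.antidiagonal (u + 1),
          (1 - p ^ (u + 1)) *
            (p ^ (x.1 * (x.1 + m)) / (qPoch p p x.1 * qPoch p p (x.1 + m) * qPoch p p x.2))
          = (1 - p ^ x.1) * (p ^ (x.1 * (x.1 + m)) /
              (qPoch p p x.1 * qPoch p p (x.1 + m) * qPoch p p x.2))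
            + (1 - p ^ x.2) * (p ^ (x.1 * (x.1 + m) + x.1) /
              (qPoch p p x.1 * qPoch p p (x.1 + m) * qPoch p p x.2)) := by
        intro x hx
        rw [← Finset.HasAntidiagonal.mem_antidiagonal.mp hx, pow_add, pow_add]
        ring
      rw [Finset.sum_congr rfl hsplit, Finset.sum_add_distrib,
        Finset.Nat.sum_antidiagonal_succ, Finset.Nat.sum_antidiagonal_succ']
      simp only [pow_zero, sub_self, zero_mul, zero_add]
      rw [← Finset.sum_add_distrib]
      refine Finset.sum_congr rfl fun x _ => ?_
      obtain ⟨d, c⟩ := x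
      simp only
      rw [show d + 1 + m = d + m + 1 by ring, show d + (m + 1) = d + m + 1 by ring,
        qPoch_self_succ p d, qPoch_self_succ p c, qPoch_self_succ p (d + m)]
      have hd := h0 d
      have hc := h0 c
      have hdm := h0 (d + m)
      have hd' := h1 d
      have hc' := h1 c
      have hdm' := h1 (d + m)
      field_simp
      ring
    rw [show u + 1 + m = u + (m + 1) by ring, qPoch_self_succ p u]
    rw [mul_right_comm, ← div_div, ← hrec, mul_div_cancel_left₀ _ (h1 u)]

lemma summable_pow_sq_mul_pow {r : ℝ} (hr0 : 0 ≤ r) (hr : r < 1) {x : ℝ} (hx : 0 ≤ x) :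
    Summable fun n : ℕ => r ^ (n ^ 2) * x ^ n := by
  have h : Tendsto (fun n : ℕ => r ^ n * x) atTop (𝓝 0) := by
    simpa using (tendsto_pow_atTop_nhds_zero_of_lt_one hr0 hr).mul_const x
  refine summable_geometric_two.of_norm_bounded_eventually_nat ?_
  filter_upwards [h.eventually_le_const (show (0 : ℝ) < 1 / 2 by norm_num)] with n hn
  rw [Real.norm_of_nonneg (by positivity), sq, pow_mul, ← mul_pow]
  exact pow_le_pow_left₀ (by positivity) hn n

lemma tsum_durfee {p : ℂ} (hp : ‖p‖ < 1) (m : ℕ) :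
    ∑' d : ℕ, p ^ (d * (d + m)) / (qPoch p p d * qPoch p p (d + m)) = (qPochInf p p)⁻¹ := by
  obtain ⟨K, hK0, hK⟩ := exists_norm_inv_qPoch_le hp
  have hE := qPochInf_self_ne_zero hp
  have hinv := (tendsto_qPoch hp p).inv₀ hE
  let F : ℕ → ℕ → ℂ := fun u d =>
    if d ≤ u then p ^ (d * (d + m)) / (qPoch p p d * qPoch p p (d + m) * qPoch p p (u - d)) else 0
  have hlim : Tendsto (fun u => ∑' d, F u d) atTop
      (𝓝 (∑' d, p ^ (d * (d + m)) / (qPoch p p d * qPoch p p (d + m)) * (qPochInf p p)⁻¹)) := by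
    refine tendsto_tsum_of_dominated_convergence
      (bound := fun d => K ^ 3 * (‖p‖ ^ (d ^ 2) * (‖p‖ ^ m) ^ d)) ?_ ?_ ?_
    · exact (summable_pow_sq_mul_pow (norm_nonneg p) hp (by positivity)).mul_left _
    · intro d
      refine Tendsto.congr' (f₁ := fun u => p ^ (d * (d + m)) /
        (qPoch p p d * qPoch p p (d + m)) * (qPoch p p (u - d))⁻¹) ?_
        ((hinv.comp (tendsto_sub_atTop_nat d)).const_mul _)
      filter_upwards [eventually_ge_atTop d] with u hu
      simp only [F, if_pos hu, div_eq_mul_inv, mul_inv, mul_assoc]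
    · refine Eventually.of_forall fun u d => ?_
      simp only [F]
      split_ifs
      · rw [div_eq_mul_inv, mul_inv, mul_inv, norm_mul, norm_mul, norm_mul, norm_pow]
        have h1 := hK d
        have h2 := hK (d + m)
        have h3 := hK (u - d)
        calc _ ≤ ‖p‖ ^ (d * (d + m)) * (K * K * K) := by gcongr
          _ = _ := by ring
      · simp only [norm_zero]; positivity
  have hfin : ∀ u, ∑' d, F u d = 1 / (qPoch p p u * qPoch p p (u + m)) := by
    intro u
    rw [← sum_antidiagonal_qPoch hp, Finset.Nat.sum_antidiagonal_eq_sum_range_succ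
      (fun d c => p ^ (d * (d + m)) / (qPoch p p d * qPoch p p (d + m) * qPoch p p c)),
      tsum_eq_sum (s := Finset.range (u + 1))]
    · refine Finset.sum_congr rfl fun d hd => ?_
      simp only [F, if_pos (Nat.lt_succ_iff.mp (Finset.mem_range.mp hd))]
    · intro d hd
      simp only [F]
      rw [if_neg]
      simpa [Nat.lt_succ_iff] using hd
  have hlim' : Tendsto (fun u => ∑' d, F u d) atTop
      (𝓝 ((qPochInf p p)⁻¹ * (qPochInf p p)⁻¹)) := by
    refine (hinv.mul (hinv.comp (tendsto_add_atTop_nat m))).congr fun u => ?_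
    simp [hfin, mul_comm]
  have h := tendsto_nhds_unique hlim hlim'
  rw [tsum_mul_right] at h
  exact mul_right_cancel₀ (inv_ne_zero hE) h

/-! ### Euler's series and the Jacobi triple product -/

/-- Euler's series `∑ q ^ u² z ^ u / (q²; q²)_u`. -/
noncomputable def eulerSeries (q z : ℂ) : ℂ :=
  ∑' u : ℕ, q ^ (u ^ 2) * z ^ u / qPoch (q ^ 2) (q ^ 2) u

/-- The theta series `∑ q ^ n² z ^ n` over the integers. -/
noncomputable def thetaSeries (q z : ℂ) : ℂ := ∑' n : ℤ, q ^ (n ^ 2) * z ^ n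

lemma norm_sq_lt_one {q : ℂ} (hq : ‖q‖ < 1) : ‖q ^ 2‖ < 1 := by
  rw [norm_pow]
  exact pow_lt_one₀ (norm_nonneg q) hq two_ne_zero

lemma summable_norm_eulerSeries {q : ℂ} (hq : ‖q‖ < 1) (z : ℂ) :
    Summable fun u : ℕ => ‖q ^ (u ^ 2) * z ^ u / qPoch (q ^ 2) (q ^ 2) u‖ := by
  obtain ⟨K, hK0, hK⟩ := exists_norm_inv_qPoch_le (norm_sq_lt_one hq)
  refine Summable.of_nonneg_of_le (fun _ => norm_nonneg _) (fun u => ?_)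
    ((summable_pow_sq_mul_pow (norm_nonneg q) hq (norm_nonneg z)).mul_right K)
  rw [div_eq_mul_inv, norm_mul, norm_mul, norm_pow, norm_pow]
  exact mul_le_mul_of_nonneg_left (hK u) (by positivity)

lemma summable_norm_thetaSeries {q : ℂ} (hq : ‖q‖ < 1) (z : ℂ) :
    Summable fun n : ℤ => ‖q ^ (n ^ 2) * z ^ n‖ := by
  refine Summable.of_nat_of_neg ?_ ?_
  · refine (summable_pow_sq_mul_pow (norm_nonneg q) hq (norm_nonneg z)).congr fun n => ?_
    rw [norm_mul, zpow_natCast, ← Nat.cast_pow, zpow_natCast, norm_pow, norm_pow]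
  · refine (summable_pow_sq_mul_pow (norm_nonneg q) hq (norm_nonneg z⁻¹)).congr fun n => ?_
    rw [norm_mul, zpow_neg, zpow_natCast, neg_sq, ← Nat.cast_pow, zpow_natCast, norm_pow,
      ← inv_pow, norm_pow]

lemma eulerSeries_eq_mul {q : ℂ} (hq : ‖q‖ < 1) (z : ℂ) :
    eulerSeries q z = (1 + q * z) * eulerSeries q (q ^ 2 * z) := by
  have hp := norm_sq_lt_one hq
  have hs := (summable_norm_eulerSeries hq z).of_norm
  have hs' := (summable_norm_eulerSeries hq (q ^ 2 * z)).of_norm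
  have h : eulerSeries q z - eulerSeries q (q ^ 2 * z)
      = q * z * eulerSeries q (q ^ 2 * z) := by
    unfold eulerSeries
    rw [← hs.tsum_sub hs', (hs.sub hs').tsum_eq_zero_add, ← tsum_mul_left]
    simp only [ne_eq, OfNat.ofNat_ne_zero, not_false_eq_true, zero_pow, pow_zero, sub_self,
      zero_add]
    refine tsum_congr fun u => ?_
    rw [qPoch_self_succ]
    have h1 := qPoch_self_ne_zero hp u
    have h2 := one_sub_pow_succ_ne_zero hp u
    field_simp
    ring
  linear_combination h

lemma eulerSeries_eq_qPochInf {q : ℂ} (hq : ‖q‖ < 1) (z : ℂ) :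
    eulerSeries q z = qPochInf (q ^ 2) (-(q * z)) := by
  have hp := norm_sq_lt_one hq
  have hiter : ∀ n : ℕ,
      eulerSeries q z = qPoch (q ^ 2) (-(q * z)) n * eulerSeries q ((q ^ 2) ^ n * z) := by
    intro n
    induction n with
    | zero => simp [qPoch]
    | succ n ih =>
      rw [ih, eulerSeries_eq_mul hq, qPoch_succ, ← mul_assoc (q ^ 2), ← pow_succ']
      ring
  have hpow : Tendsto (fun n : ℕ => (q ^ 2) ^ n * z) atTop (𝓝 0) := by
    simpa using (tendsto_pow_atTop_nhds_zero_of_norm_lt_one hp).mul_const z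
  have hone : Tendsto (fun n : ℕ => eulerSeries q ((q ^ 2) ^ n * z)) atTop (𝓝 1) := by
    have h1 : (1 : ℂ) = ∑' u : ℕ, q ^ (u ^ 2) * 0 ^ u / qPoch (q ^ 2) (q ^ 2) u := by
      rw [tsum_eq_single 0 (fun u hu => by simp [hu])]
      simp [qPoch]
    rw [h1]
    refine tendsto_tsum_of_dominated_convergence (summable_norm_eulerSeries hq z)
      (fun u => ((hpow.pow u).const_mul _).div_const _) (Eventually.of_forall fun n u => ?_)
    simp only [norm_div, norm_mul, norm_pow]
    rw [mul_pow]
    have : (‖q‖ ^ 2) ^ n ≤ 1 := pow_le_one₀ (by positivity) (by simpa using hp.le)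
    have h2 : ((‖q‖ ^ 2) ^ n) ^ u ≤ 1 := pow_le_one₀ (by positivity) this
    gcongr
    exact mul_le_of_le_one_left (by positivity) h2
  have hlim := ((tendsto_qPoch hp (-(q * z))).mul hone).congr fun n => (hiter n).symm
  rw [mul_one] at hlim
  exact tendsto_nhds_unique tendsto_const_nhds hlim

/-- Pairs of naturals are parametrized by their difference and their minimum. -/
def diffMinEquiv : ℤ × ℕ ≃ ℕ × ℕ where
  toFun x := (x.2 + x.1.toNat, x.2 + (-x.1).toNat)
  invFun y := ((y.1 : ℤ) - y.2, min y.1 y.2)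
  left_inv x := by
    obtain ⟨n, k⟩ := x
    simp only [Prod.mk.injEq]
    omega
  right_inv y := by
    obtain ⟨a, d⟩ := y
    simp only [Prod.mk.injEq]
    omega

lemma eulerSeries_mul_eulerSeries_inv {q : ℂ} (hq : ‖q‖ < 1) {z : ℂ} (hz : z ≠ 0) :
    eulerSeries q z * eulerSeries q z⁻¹ = (qPochInf (q ^ 2) (q ^ 2))⁻¹ * thetaSeries q z := by
  have hp := norm_sq_lt_one hq
  have h1 := summable_norm_eulerSeries hq z
  have h2 := summable_norm_eulerSeries hq z⁻¹
  have hs := diffMinEquiv.summable_iff.mpr (summable_mul_of_summable_norm h1 h2)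
  unfold eulerSeries thetaSeries
  rw [tsum_mul_tsum_of_summable_norm h1 h2, ← diffMinEquiv.tsum_eq, ← tsum_mul_left]
  refine hs.tsum_prod.trans (tsum_congr fun n => ?_)
  rw [← tsum_durfee hp n.natAbs, ← tsum_mul_right]
  refine tsum_congr fun k => ?_
  simp only [diffMinEquiv, Equiv.coe_fn_mk, Function.comp]
  have key : ∀ m : ℕ, q ^ ((k + m) ^ 2) * q ^ (k ^ 2) = (q ^ 2) ^ (k * (k + m)) * q ^ (m ^ 2) := by
    intro m
    ring
  obtain ⟨m, rfl | rfl⟩ := n.eq_nat_or_neg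
  · simp only [Int.toNat_natCast, Int.toNat_neg_natCast, add_zero, Int.natAbs_natCast,
      zpow_natCast, inv_pow, ← Nat.cast_pow]
    have hzk : z ^ (k + m) * (z ^ k)⁻¹ = z ^ m := by
      rw [pow_add]; field_simp
    rw [div_mul_div_comm, div_mul_eq_mul_div, mul_comm (qPoch _ _ k)]
    congr 1
    rw [← hzk]
    linear_combination (z ^ (k + m) * (z ^ k)⁻¹) * key m
  · simp only [neg_neg, Int.toNat_natCast, Int.toNat_neg_natCast, add_zero, Int.natAbs_neg,
      Int.natAbs_natCast, neg_sq, zpow_neg, zpow_natCast, inv_pow, ← Nat.cast_pow]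
    have hzk : z ^ k * (z ^ (k + m))⁻¹ = (z ^ m)⁻¹ := by
      rw [pow_add]; field_simp
    rw [div_mul_div_comm, div_mul_eq_mul_div]
    congr 1
    rw [← hzk]
    linear_combination (z ^ k * (z ^ (k + m))⁻¹) * key m

/-- The Jacobi triple product identity. -/
lemma thetaSeries_eq_qPochInf {q : ℂ} (hq : ‖q‖ < 1) {z : ℂ} (hz : z ≠ 0) :
    thetaSeries q z = qPochInf (q ^ 2) (q ^ 2) * qPochInf (q ^ 2) (-(q * z)) *
      qPochInf (q ^ 2) (-(q * z⁻¹)) := by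
  rw [mul_assoc, ← eulerSeries_eq_qPochInf hq, ← eulerSeries_eq_qPochInf hq,
    eulerSeries_mul_eulerSeries_inv hq hz,
    mul_inv_cancel_left₀ (qPochInf_self_ne_zero (norm_sq_lt_one hq))]

/-! ### The cubic theta function -/

/-- The theta series of the hexagonal lattice shifted to a deep hole. -/
noncomputable def cubicTheta (q : ℂ) : ℂ :=
  ∑' x : ℤ × ℤ, q ^ (x.1 ^ 2 + x.1 * x.2 + x.2 ^ 2 - x.1 - x.2)

lemma summable_cubicTheta {q : ℂ} (hq : ‖q‖ < 1) (hq0 : q ≠ 0) :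
    Summable fun x : ℤ × ℤ => q ^ (x.1 ^ 2 + x.1 * x.2 + x.2 ^ 2 - x.1 - x.2) := by
  obtain ⟨t, rfl⟩ := IsAlgClosed.exists_pow_nat_eq q (n := 2) two_pos
  have ht0 : t ≠ 0 := by rintro rfl; simp at hq0
  have htpos : 0 < ‖t‖ := norm_pos_iff.mpr ht0
  have ht : ‖t‖ < 1 := by
    rw [norm_pow] at hq
    exact (pow_lt_one_iff_of_nonneg htpos.le two_ne_zero).mp hq
  have h := summable_norm_thetaSeries ht (t ^ (-2 : ℤ))
  refine (h.mul_of_nonneg h (fun _ => norm_nonneg _) (fun _ => norm_nonneg _)).of_norm_bounded ?_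
  rintro ⟨n, k⟩
  simp only [← norm_mul]
  rw [← zpow_natCast t 2, ← zpow_mul, ← zpow_mul, ← zpow_mul, ← zpow_add₀ ht0, ← zpow_add₀ ht0,
    ← zpow_add₀ ht0, norm_zpow, norm_zpow]
  refine zpow_le_zpow_right_of_le_one₀ htpos ht.le ?_
  push_cast
  nlinarith [sq_nonneg (n + k)]

/-- Integer triples, parametrized by the residue mod 3 and the integral part of a third of
their sum together with two of the shifted entries. -/
def tripleSumEquiv : Fin 3 × ℤ × ℤ × ℤ ≃ ℤ × ℤ × ℤ where
  toFun x := (x.2.2.1 + x.2.1, x.2.2.2 + x.2.1, (x.1 : ℕ) - x.2.2.1 - x.2.2.2 + x.2.1)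
  invFun y := (⟨((y.1 + y.2.1 + y.2.2) % 3).toNat, by omega⟩, (y.1 + y.2.1 + y.2.2) / 3,
    y.1 - (y.1 + y.2.1 + y.2.2) / 3, y.2.1 - (y.1 + y.2.1 + y.2.2) / 3)
  left_inv x := by
    obtain ⟨⟨i, hi⟩, k, x, y⟩ := x
    simp only [Prod.mk.injEq, Fin.mk.injEq]
    omega
  right_inv y := by
    obtain ⟨a, b, c⟩ := y
    simp only [Prod.mk.injEq]
    omega

lemma tsum_neg_one_zpow_mul_zpow_eq_zero (q : ℂ) :
    ∑' k : ℤ, (-1 : ℂ) ^ k * q ^ (3 * k ^ 2 - 3 * k) = 0 := by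
  have h := (Equiv.subLeft (1 : ℤ)).tsum_eq fun k : ℤ => (-1 : ℂ) ^ k * q ^ (3 * k ^ 2 - 3 * k)
  have h' : ∀ k : ℤ, (-1 : ℂ) ^ (Equiv.subLeft (1 : ℤ) k) *
      q ^ (3 * (Equiv.subLeft (1 : ℤ) k) ^ 2 - 3 * (Equiv.subLeft (1 : ℤ) k))
      = -((-1 : ℂ) ^ k * q ^ (3 * k ^ 2 - 3 * k)) := by
    intro k
    simp only [Equiv.subLeft_apply]
    rw [zpow_sub₀ (by norm_num), zpow_one, div_eq_mul_inv, ← inv_zpow, inv_neg_one,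
      show 3 * (1 - k) ^ 2 - 3 * (1 - k) = 3 * k ^ 2 - 3 * k by ring]
    ring
  simp only [h', tsum_neg] at h
  exact self_eq_neg.mp h.symm

/-- Euler's pentagonal number theorem. -/
lemma tsum_pentagonal {q : ℂ} (hq : ‖q‖ < 1) (hq0 : q ≠ 0) :
    ∑' k : ℤ, (-1 : ℂ) ^ k * q ^ (3 * k ^ 2 + k) = qPochInf (q ^ 2) (q ^ 2) := by
  have hq3 : ‖q ^ 3‖ < 1 := by
    rw [norm_pow]; exact pow_lt_one₀ (norm_nonneg q) hq (by norm_num)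
  have h := thetaSeries_eq_qPochInf hq3 (neg_ne_zero.mpr hq0)
  rw [qPochInf_trisection (norm_sq_lt_one hq)]
  rw [show -(q ^ 3 * -q) = (q ^ 2) ^ 2 by ring,
    show -(q ^ 3 * (-q)⁻¹) = q ^ 2 by field_simp, show (q ^ 3) ^ 2 = (q ^ 2) ^ 3 by ring,
    mul_right_comm] at h
  rw [← h]
  refine tsum_congr fun k => ?_
  rw [neg_eq_neg_one_mul q, mul_zpow, ← zpow_natCast q 3, ← zpow_mul, zpow_add₀ hq0]
  push_cast
  ring

lemma tsum_pentagonal_neg {q : ℂ} (hq : ‖q‖ < 1) (hq0 : q ≠ 0) :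
    ∑' k : ℤ, (-1 : ℂ) ^ k * q ^ (3 * k ^ 2 - k) = qPochInf (q ^ 2) (q ^ 2) := by
  rw [← tsum_pentagonal hq hq0, ← (Equiv.neg ℤ).tsum_eq]
  refine tsum_congr fun k => ?_
  rw [Equiv.neg_apply, neg_sq, sub_neg_eq_add, zpow_neg, ← inv_zpow, inv_neg_one]

lemma thetaSeries_cube_root {q : ℂ} (hq : ‖q‖ < 1) (hq0 : q ≠ 0) {w : ℂ}
    (hw : w ^ 2 + w + 1 = 0) :
    thetaSeries q (-w * q⁻¹) = (1 - w) * qPochInf ((q ^ 2) ^ 3) ((q ^ 2) ^ 3) := by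
  have hp := norm_sq_lt_one hq
  have hw0 : w ≠ 0 := by rintro rfl; simp at hw
  have hw3 : w ^ 3 = 1 := by linear_combination (w - 1) * hw
  rw [thetaSeries_eq_qPochInf hq (mul_ne_zero (neg_ne_zero.mpr hw0) (inv_ne_zero hq0)),
    show -(q * (-w * q⁻¹)) = w by field_simp,
    show -(q * (-w * q⁻¹)⁻¹) = w ^ 2 * q ^ 2 by
      field_simp
      linear_combination -hw3,
    qPochInf_eq_one_sub_mul hp w, ← qPochInf_cube hp hw]
  ring

lemma thetaSeries_pow_three {q : ℂ} (hq : ‖q‖ < 1) (hq0 : q ≠ 0) {w : ℂ}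
    (hw : w ^ 2 + w + 1 = 0) :
    thetaSeries q (-w * q⁻¹) ^ 3 =
      (w ^ 2 - w) * (cubicTheta (q ^ 2) * qPochInf (q ^ 2) (q ^ 2)) := by
  have hw0 : w ≠ 0 := by rintro rfl; simp at hw
  have hw3 : w ^ 3 = 1 := by linear_combination (w - 1) * hw
  have hterm : ∀ n : ℤ, q ^ (n ^ 2) * (-w * q⁻¹) ^ n = q ^ (n ^ 2 - n) * (-w) ^ n := by
    intro n
    rw [mul_zpow, inv_zpow, zpow_sub₀ hq0]
    ring
  have hs := summable_norm_thetaSeries hq (-w * q⁻¹)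
  simp only [hterm] at hs
  have hs2 := hs.mul_norm hs
  have hs3 := summable_mul_of_summable_norm hs hs2
  have hs3' := tripleSumEquiv.summable_iff.mpr hs3
  let G : Fin 3 → ℤ → ℂ := fun i k => (-1) ^ k * q ^ (3 * k ^ 2 - 3 * k + 2 * (i : ℕ) * k)
  let H : Fin 3 → ℤ × ℤ → ℂ := fun i x =>
    (-w) ^ (i : ℕ) * (q ^ 2) ^ (x.1 ^ 2 + x.1 * x.2 + x.2 ^ 2
      - (i : ℕ) * (x.1 + x.2) + (((i : ℕ) * ((i : ℕ) - 1) / 2 : ℕ) : ℤ))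
  have hfactor : ∀ (i : Fin 3) (y : ℤ × ℤ × ℤ), ((fun x : ℤ × ℤ × ℤ =>
      q ^ (x.1 ^ 2 - x.1) * (-w) ^ x.1 * (q ^ (x.2.1 ^ 2 - x.2.1) * (-w) ^ x.2.1 *
        (q ^ (x.2.2 ^ 2 - x.2.2) * (-w) ^ x.2.2))) ∘ tripleSumEquiv) (i, y)
      = G i y.1 * H i y.2 := by
    intro i y
    obtain ⟨k, x, y⟩ := y
    simp only [tripleSumEquiv, Equiv.coe_fn_mk, Function.comp, G, H]
    have hw' : -w ≠ 0 := neg_ne_zero.mpr hw0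
    have hsgn : (-w) ^ (x + k) * ((-w) ^ (y + k) * (-w) ^ ((i : ℕ) - x - y + k : ℤ))
        = (-1) ^ k * (-w) ^ (i : ℕ) := by
      rw [← zpow_add₀ hw', ← zpow_add₀ hw', ← zpow_natCast (-w),
        show (-1 : ℂ) = (-w) ^ (3 : ℤ) by
          rw [show (3 : ℤ) = ((3 : ℕ) : ℤ) by norm_num, zpow_natCast]
          linear_combination hw3,
        ← zpow_mul, ← zpow_add₀ hw']
      congr 1
      ring
    have hpow : q ^ ((x + k) ^ 2 - (x + k)) * (q ^ ((y + k) ^ 2 - (y + k)) *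
        q ^ (((i : ℕ) - x - y + k : ℤ) ^ 2 - ((i : ℕ) - x - y + k)))
        = q ^ (3 * k ^ 2 - 3 * k + 2 * (i : ℕ) * k) * (q ^ 2) ^ (x ^ 2 + x * y + y ^ 2
        - (i : ℕ) * (x + y) + (((i : ℕ) * ((i : ℕ) - 1) / 2 : ℕ) : ℤ)) := by
      rw [← zpow_natCast q 2, ← zpow_mul, ← zpow_add₀ hq0, ← zpow_add₀ hq0, ← zpow_add₀ hq0]
      congr 1
      fin_cases i <;> push_cast <;> norm_num <;> ring
    linear_combination (q ^ ((x + k) ^ 2 - (x + k)) * (q ^ ((y + k) ^ 2 - (y + k)) *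
        q ^ (((i : ℕ) - x - y + k : ℤ) ^ 2 - ((i : ℕ) - x - y + k)))) * hsgn +
        ((-1) ^ k * (-w) ^ (i : ℕ)) * hpow
  have hsum : thetaSeries q (-w * q⁻¹) ^ 3 = ∑ i : Fin 3, (∑' k, G i k) * ∑' x, H i x := by
    unfold thetaSeries
    simp only [hterm]
    rw [pow_succ', sq, tsum_mul_tsum_of_summable_norm hs hs, tsum_mul_tsum_of_summable_norm hs hs2,
      ← tripleSumEquiv.tsum_eq, ← tsum_fintype (L := .unconditional _)]
    refine hs3'.tsum_prod.trans (tsum_congr fun i => ?_)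
    have hsi : Summable fun y : ℤ × ℤ × ℤ => G i y.1 * H i y.2 :=
      (hs3'.prod_factor i).congr (hfactor i)
    rw [tsum_congr (hfactor i), hsi.tsum_prod]
    simp only [tsum_mul_left, tsum_mul_right]
  have hG0 : ∑' k, G 0 k = 0 := by
    simpa [G] using tsum_neg_one_zpow_mul_zpow_eq_zero q
  have hG1 : ∑' k, G 1 k = qPochInf (q ^ 2) (q ^ 2) := by
    rw [← tsum_pentagonal_neg hq hq0]
    refine tsum_congr fun k => ?_
    simp only [G]
    congr 2
    simp only [Fin.val_one]
    push_cast
    ring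
  have hG2 : ∑' k, G 2 k = qPochInf (q ^ 2) (q ^ 2) := by
    rw [← tsum_pentagonal hq hq0]
    refine tsum_congr fun k => ?_
    simp only [G]
    congr 2
    simp only [Fin.val_two]
    push_cast
    ring
  have hH1 : ∑' x, H 1 x = -w * cubicTheta (q ^ 2) := by
    rw [cubicTheta, ← tsum_mul_left]
    refine tsum_congr fun x => ?_
    simp only [H]
    congr 1
    · simp
    · congr 1
      norm_num
      ring
  have hH2 : ∑' x, H 2 x = w ^ 2 * cubicTheta (q ^ 2) := by
    rw [cubicTheta, ← tsum_mul_left,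
      ← ((Equiv.subLeft (1 : ℤ)).prodCongr (Equiv.subLeft (1 : ℤ))).tsum_eq]
    refine tsum_congr fun x => ?_
    simp only [H]
    congr 1
    · simp
    · congr 1
      simp
      ring
  rw [hsum, Fin.sum_univ_three, hG0, hG1, hG2, hH1, hH2]
  ring

lemma cubicTheta_mul_qPochInf {q : ℂ} (hq : ‖q‖ < 1) (hq0 : q ≠ 0) :
    cubicTheta q * qPochInf q q = 3 * qPochInf (q ^ 3) (q ^ 3) ^ 3 := by
  obtain ⟨t, rfl⟩ := IsAlgClosed.exists_pow_nat_eq q (n := 2) two_pos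
  have ht0 : t ≠ 0 := by rintro rfl; simp at hq0
  have ht : ‖t‖ < 1 := by
    rw [norm_pow] at hq
    exact (pow_lt_one_iff_of_nonneg (norm_nonneg t) two_ne_zero).mp hq
  obtain ⟨s, hs⟩ := IsAlgClosed.exists_pow_nat_eq (-3 : ℂ) (n := 2) two_pos
  have hw : ((s - 1) / 2) ^ 2 + (s - 1) / 2 + 1 = 0 := by linear_combination hs / 4
  have h := thetaSeries_pow_three ht ht0 hw
  rw [thetaSeries_cube_root ht ht0 hw] at h
  have hs0 : s ≠ 0 := by rintro rfl; norm_num at hs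
  have hne : ((s - 1) / 2) ^ 2 - (s - 1) / 2 ≠ 0 := by
    rw [show ((s - 1) / 2) ^ 2 - (s - 1) / 2 = -s by linear_combination hs / 4]
    exact neg_ne_zero.mpr hs0
  refine mul_left_cancel₀ hne ?_
  rw [← h]
  generalize qPochInf ((t ^ 2) ^ 3) ((t ^ 2) ^ 3) = E
  linear_combination (-((s - 1) / 2) + 1) * E ^ 3 * hw

/-! ### Reduction of the sextuple sum -/

/-- The summand of the `q`-Vandermonde sum, extended by zero. -/
noncomputable def vandermondeTerm (q : ℂ) (u v c : ℕ) : ℂ :=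
  if c ≤ u ∧ c ≤ v then q ^ ((u - c) ^ 2 + (v - c) ^ 2) /
    (qPoch (q ^ 2) (q ^ 2) (u - c) * qPoch (q ^ 2) (q ^ 2) (v - c) * qPoch (q ^ 2) (q ^ 2) c)
  else 0

lemma vandermondeTerm_add (q : ℂ) (a b c : ℕ) :
    vandermondeTerm q (a + c) (b + c) c = q ^ (a ^ 2 + b ^ 2) /
      (qPoch (q ^ 2) (q ^ 2) a * qPoch (q ^ 2) (q ^ 2) b * qPoch (q ^ 2) (q ^ 2) c) := by
  simp [vandermondeTerm]

lemma vandermondeTerm_comm (q : ℂ) (u v c : ℕ) :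
    vandermondeTerm q u v c = vandermondeTerm q v u c := by
  unfold vandermondeTerm
  refine if_congr and_comm ?_ rfl
  rw [add_comm, mul_comm (qPoch _ _ (u - c))]

lemma tsum_vandermondeTerm {q : ℂ} (hq : ‖q‖ < 1) (u v : ℕ) :
    ∑' c, vandermondeTerm q u v c = q ^ (((u : ℤ) - v) ^ 2) /
      (qPoch (q ^ 2) (q ^ 2) u * qPoch (q ^ 2) (q ^ 2) v) := by
  wlog huv : u ≤ v generalizing u v with H
  · simp only [vandermondeTerm_comm q u v]
    rw [H v u (by omega), mul_comm (qPoch _ _ v), ← neg_sq, neg_sub]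
  obtain ⟨m, rfl⟩ := Nat.exists_eq_add_of_le huv
  rw [tsum_eq_sum (s := Finset.range (u + 1))]
  · have h := sum_antidiagonal_qPoch (norm_sq_lt_one hq) u m
    rw [← Finset.Nat.sum_antidiagonal_swap, Finset.Nat.sum_antidiagonal_eq_sum_range_succ_mk] at h
    have hm : q ^ (((u : ℤ) - (u + m : ℕ)) ^ 2) = q ^ (m ^ 2) := by
      rw [← zpow_natCast]
      congr 1
      push_cast
      ring
    rw [hm, ← mul_one_div, ← h, Finset.mul_sum]
    refine Finset.sum_congr rfl fun c hc => ?_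
    obtain ⟨d, rfl⟩ := Nat.exists_eq_add_of_le' (Nat.lt_succ_iff.mp (Finset.mem_range.mp hc))
    rw [show d + c + m = d + m + c by ring, vandermondeTerm_add]
    simp only [Prod.swap, Nat.add_sub_cancel]
    rw [← mul_div_assoc]
    congr 1
    ring
  · intro c hc
    have : ¬ (c ≤ u ∧ c ≤ u + m) := by
      simp only [Finset.mem_range] at hc
      omega
    simp [vandermondeTerm, this]

/-- The summand of the sextuple sum. -/
noncomputable def sextupleTerm (q : ℂ) (n : ℕ × ℕ × ℕ × ℕ × ℕ × ℕ) : ℂ :=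
  q ^ ((Q4 n.1 n.2.1 n.2.2.1 n.2.2.2.1 n.2.2.2.2.1 n.2.2.2.2.2 : ℤ) -
      ((n.1 : ℤ) + n.2.2.1 + n.2.2.2.1 + n.2.2.2.2.2)) /
    (qPoch (q ^ 2) (q ^ 2) n.1 * qPoch (q ^ 2) (q ^ 2) n.2.1 *
      qPoch (q ^ 2) (q ^ 2) n.2.2.1 * qPoch (q ^ 2) (q ^ 2) n.2.2.2.1 *
      qPoch (q ^ 2) (q ^ 2) n.2.2.2.2.1 * qPoch (q ^ 2) (q ^ 2) n.2.2.2.2.2)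

lemma summable_sextupleTerm {q : ℂ} (hq : ‖q‖ < 1) (hq0 : q ≠ 0) :
    Summable (sextupleTerm q) := by
  obtain ⟨K, hK0, hK⟩ := exists_norm_inv_qPoch_le (norm_sq_lt_one hq)
  have hr0 : 0 < ‖q‖ := norm_pos_iff.mpr hq0
  let s : ℕ → ℝ := fun n => ‖q‖ ^ (n ^ 2) * ‖q‖⁻¹ ^ n * K
  have hs0 : ∀ n, 0 ≤ s n := fun n => by positivity
  have hs : Summable s :=
    (summable_pow_sq_mul_pow (norm_nonneg q) hq (by positivity)).mul_right K
  have h2 := hs.mul_of_nonneg hs hs0 hs0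
  have h3 := hs.mul_of_nonneg h2 hs0 fun x => mul_nonneg (hs0 _) (hs0 _)
  have h4 := hs.mul_of_nonneg h3 hs0 fun x => by positivity
  have h5 := hs.mul_of_nonneg h4 hs0 fun x => by positivity
  have h6 := hs.mul_of_nonneg h5 hs0 fun x => by positivity
  refine h6.of_norm_bounded ?_
  rintro ⟨a, b, c, d, e, f⟩
  simp only [sextupleTerm, div_eq_mul_inv, mul_inv, norm_mul, norm_zpow]
  have hexp : ‖q‖ ^ ((Q4 a b c d e f : ℤ) - ((a : ℤ) + c + d + f)) ≤
      ‖q‖ ^ (((a ^ 2 + b ^ 2 + c ^ 2 + d ^ 2 + e ^ 2 + f ^ 2 : ℕ) : ℤ) -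
        ((a + b + c + d + e + f : ℕ) : ℤ)) := by
    refine zpow_le_zpow_right_of_le_one₀ hr0 hq.le ?_
    have : a ^ 2 + b ^ 2 + c ^ 2 + d ^ 2 + e ^ 2 + f ^ 2 ≤ Q4 a b c d e f := by
      unfold Q4
      simp only [add_assoc]
      gcongr
      exact Nat.le_add_right _ _
    zify at this
    push_cast
    linarith
  calc _ ≤ ‖q‖ ^ (((a ^ 2 + b ^ 2 + c ^ 2 + d ^ 2 + e ^ 2 + f ^ 2 : ℕ) : ℤ) -
        ((a + b + c + d + e + f : ℕ) : ℤ)) * (K * K * K * K * K * K) := by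
        gcongr <;> apply hK
    _ = _ := by
      rw [zpow_sub₀ hr0.ne', zpow_natCast, zpow_natCast]
      simp only [s, inv_pow]
      field_simp
      ring

/-- The summand of the quadruple sum obtained by applying the `q`-Vandermonde sum twice. -/
noncomputable def quadrupleTerm (q : ℂ) (x : (ℕ × ℕ) × (ℕ × ℕ)) : ℂ :=
  q ^ (((x.1.1 : ℤ) + x.1.2) * (x.2.1 + x.2.2) - (x.1.1 + x.1.2)) *
    (q ^ (((x.1.1 : ℤ) - x.2.1) ^ 2) /
      (qPoch (q ^ 2) (q ^ 2) x.1.1 * qPoch (q ^ 2) (q ^ 2) x.2.1)) *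
    (q ^ (((x.1.2 : ℤ) - x.2.2) ^ 2) /
      (qPoch (q ^ 2) (q ^ 2) x.1.2 * qPoch (q ^ 2) (q ^ 2) x.2.2))

lemma hasSum_quadrupleTerm {q : ℂ} (hq : ‖q‖ < 1) (hq0 : q ≠ 0) :
    HasSum (quadrupleTerm q) (∑' n, sextupleTerm q n) := by
  let g : ((ℕ × ℕ) × (ℕ × ℕ)) × (ℕ × ℕ) → ℂ := fun y =>
    q ^ (((y.1.1.1 : ℤ) + y.1.1.2) * (y.1.2.1 + y.1.2.2) - (y.1.1.1 + y.1.1.2)) *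
      vandermondeTerm q y.1.1.1 y.1.2.1 y.2.1 * vandermondeTerm q y.1.1.2 y.1.2.2 y.2.2
  let ι : ℕ × ℕ × ℕ × ℕ × ℕ × ℕ → ((ℕ × ℕ) × (ℕ × ℕ)) × (ℕ × ℕ) := fun n =>
    (((n.1 + n.2.2.1, n.2.2.2.1 + n.2.2.2.2.2), (n.2.1 + n.2.2.1, n.2.2.2.2.1 + n.2.2.2.2.2)),
      (n.2.2.1, n.2.2.2.2.2))
  have hι : Function.Injective ι := by
    rintro ⟨a, b, c, d, e, f⟩ ⟨a', b', c', d', e', f'⟩ h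
    simp only [ι, Prod.mk.injEq] at h ⊢
    omega
  have hsupp : ∀ y ∉ Set.range ι, g y = 0 := by
    rintro ⟨⟨⟨u₁, u₂⟩, v₁, v₂⟩, c, f⟩ hy
    by_contra hne
    have hc : c ≤ u₁ ∧ c ≤ v₁ := by
      by_contra hc
      simp [g, vandermondeTerm, hc] at hne
    have hf : f ≤ u₂ ∧ f ≤ v₂ := by
      by_contra hf
      simp [g, vandermondeTerm, hf] at hne
    refine hy ⟨(u₁ - c, v₁ - c, c, u₂ - f, v₂ - f, f), ?_⟩
    simp [ι, hc, hf]
  have hgι : ∀ n, g (ι n) = sextupleTerm q n := by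
    rintro ⟨a, b, c, d, e, f⟩
    simp only [g, ι, sextupleTerm, vandermondeTerm_add]
    rw [mul_assoc, div_mul_div_comm, ← mul_div_assoc]
    congr 1
    · rw [← zpow_natCast, ← zpow_natCast, ← zpow_add₀ hq0, ← zpow_add₀ hq0]
      congr 1
      simp only [Q4]
      push_cast
      ring
    · ring
  have hg : Summable g := by
    rw [← hι.summable_iff hsupp]
    exact (summable_sextupleTerm hq hq0).congr fun n => (hgι n).symm
  have hfiber : ∀ x, ∑' y, g (x, y) = quadrupleTerm q x := by
    intro x
    rw [(hg.prod_factor x).tsum_prod]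
    simp only [g, tsum_mul_left, tsum_mul_right, tsum_vandermondeTerm hq, quadrupleTerm]
  have hsum := hg.prod
  rw [funext hfiber] at hsum
  have htsum : ∑' n, sextupleTerm q n = ∑' x, quadrupleTerm q x := by
    rw [← tsum_congr hfiber, ← hg.tsum_prod, ← hι.tsum_eq (f := g), tsum_congr hgι]
    exact Function.support_subset_iff'.mpr hsupp
  rw [htsum]
  exact hsum.hasSum

lemma tsum_quadrupleTerm_snd {q : ℂ} (hq : ‖q‖ < 1) (hq0 : q ≠ 0) (u : ℕ × ℕ) :
    ∑' v, quadrupleTerm q (u, v) = (qPochInf (q ^ 2) (q ^ 2))⁻¹ * ∑' n : ℤ,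
      q ^ (n ^ 2) * (q ^ (u.1 ^ 2) * (q ^ (-n - 1)) ^ u.1 / qPoch (q ^ 2) (q ^ 2) u.1 *
        (q ^ (u.2 ^ 2) * (q ^ (n - 1)) ^ u.2 / qPoch (q ^ 2) (q ^ 2) u.2)) := by
  obtain ⟨u₁, u₂⟩ := u
  have hz : q ^ ((u₂ : ℤ) - u₁) ≠ 0 := zpow_ne_zero _ hq0
  have h := eulerSeries_mul_eulerSeries_inv hq hz
  unfold eulerSeries thetaSeries at h
  rw [tsum_mul_tsum_of_summable_norm (summable_norm_eulerSeries hq _)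
    (summable_norm_eulerSeries hq _)] at h
  have h1 : ∀ v : ℕ × ℕ, quadrupleTerm q ((u₁, u₂), v)
      = q ^ ((u₁ : ℤ) ^ 2 + (u₂ : ℤ) ^ 2 - u₁ - u₂) /
        (qPoch (q ^ 2) (q ^ 2) u₁ * qPoch (q ^ 2) (q ^ 2) u₂) *
        (q ^ (v.1 ^ 2) * (q ^ ((u₂ : ℤ) - u₁)) ^ v.1 / qPoch (q ^ 2) (q ^ 2) v.1 *
          (q ^ (v.2 ^ 2) * (q ^ ((u₂ : ℤ) - u₁))⁻¹ ^ v.2 / qPoch (q ^ 2) (q ^ 2) v.2)) := by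
    rintro ⟨v₁, v₂⟩
    simp only [quadrupleTerm]
    rw [div_mul_div_comm, div_mul_div_comm, mul_assoc, div_mul_div_comm, ← mul_div_assoc]
    congr 1
    · simp only [← zpow_natCast, ← zpow_neg, ← zpow_mul, ← zpow_add₀ hq0]
      congr 1
      push_cast
      ring
    · ring
  rw [tsum_congr h1, tsum_mul_left, h, mul_left_comm, ← tsum_mul_left]
  congr 1
  refine tsum_congr fun n => ?_
  rw [div_mul_div_comm, div_mul_eq_mul_div, ← mul_div_assoc]
  congr 1
  simp only [← zpow_natCast, ← zpow_mul, ← zpow_add₀ hq0]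
  congr 1
  push_cast
  ring

lemma summable_theta_mul_euler {q : ℂ} (hq : ‖q‖ < 1) (hq0 : q ≠ 0) :
    Summable fun x : (ℕ × ℕ) × ℤ => q ^ (x.2 ^ 2) *
      (q ^ (x.1.1 ^ 2) * (q ^ (-x.2 - 1)) ^ x.1.1 / qPoch (q ^ 2) (q ^ 2) x.1.1 *
        (q ^ (x.1.2 ^ 2) * (q ^ (x.2 - 1)) ^ x.1.2 / qPoch (q ^ 2) (q ^ 2) x.1.2)) := by
  obtain ⟨K, hK0, hK⟩ := exists_norm_inv_qPoch_le (norm_sq_lt_one hq)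
  obtain ⟨t, rfl⟩ := IsAlgClosed.exists_pow_nat_eq q (n := 2) two_pos
  have ht0 : t ≠ 0 := by rintro rfl; simp at hq0
  have htpos : 0 < ‖t‖ := norm_pos_iff.mpr ht0
  have ht : ‖t‖ < 1 := by
    rw [norm_pow] at hq
    exact (pow_lt_one_iff_of_nonneg htpos.le two_ne_zero).mp hq
  let s : ℕ → ℝ := fun n => ‖t‖ ^ (n ^ 2) * (‖t‖ ^ (-2 : ℤ)) ^ n * K
  have hs0 : ∀ n, 0 ≤ s n := fun n => by positivity
  have hs : Summable s :=
    (summable_pow_sq_mul_pow (norm_nonneg t) ht (by positivity)).mul_right K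
  have hθ := summable_norm_thetaSeries ht 1
  refine ((hs.mul_of_nonneg hs hs0 hs0).mul_of_nonneg hθ (fun x => mul_nonneg (hs0 _) (hs0 _))
    fun _ => norm_nonneg _).of_norm_bounded ?_
  rintro ⟨⟨u₁, u₂⟩, n⟩
  simp only [one_zpow, mul_one, s, div_eq_mul_inv, norm_mul, norm_zpow, norm_pow]
  have hexp : (‖t‖ ^ 2) ^ (n ^ 2) * ((‖t‖ ^ 2) ^ (u₁ ^ 2) * ((‖t‖ ^ 2) ^ (-n - 1)) ^ u₁ *
      ((‖t‖ ^ 2) ^ (u₂ ^ 2) * ((‖t‖ ^ 2) ^ (n - 1)) ^ u₂)) ≤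
      ‖t‖ ^ (u₁ ^ 2) * (‖t‖ ^ (-2 : ℤ)) ^ u₁ * (‖t‖ ^ (u₂ ^ 2) * (‖t‖ ^ (-2 : ℤ)) ^ u₂) *
        ‖t‖ ^ (n ^ 2) := by
    simp only [← zpow_natCast, ← zpow_mul, ← zpow_add₀ htpos.ne']
    refine zpow_le_zpow_right_of_le_one₀ htpos ht.le ?_
    push_cast
    have h : (0 : ℤ) ≤ (u₁ : ℤ) * u₂ := by positivity
    nlinarith [sq_nonneg (n + u₂ - u₁)]
  have h1 := hK u₁
  have h2 := hK u₂
  calc _ = (‖t‖ ^ 2) ^ (n ^ 2) * ((‖t‖ ^ 2) ^ (u₁ ^ 2) * ((‖t‖ ^ 2) ^ (-n - 1)) ^ u₁ *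
      ((‖t‖ ^ 2) ^ (u₂ ^ 2) * ((‖t‖ ^ 2) ^ (n - 1)) ^ u₂)) *
        (‖(qPoch ((t ^ 2) ^ 2) ((t ^ 2) ^ 2) u₁)⁻¹‖ *
          ‖(qPoch ((t ^ 2) ^ 2) ((t ^ 2) ^ 2) u₂)⁻¹‖) := by ring
    _ ≤ ‖t‖ ^ (u₁ ^ 2) * (‖t‖ ^ (-2 : ℤ)) ^ u₁ * (‖t‖ ^ (u₂ ^ 2) * (‖t‖ ^ (-2 : ℤ)) ^ u₂) *
        ‖t‖ ^ (n ^ 2) * (K * K) := by gcongr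
    _ = _ := by ring

lemma theta_mul_eulerSeries {q : ℂ} (hq : ‖q‖ < 1) (hq0 : q ≠ 0) (n : ℤ) :
    q ^ (n ^ 2) * (eulerSeries q (q ^ (-n - 1)) * eulerSeries q (q ^ (n - 1))) =
      (qPochInf (q ^ 2) (q ^ 2))⁻¹ * ((∑' k : ℤ, q ^ (n ^ 2 + n * k + k ^ 2 - k)) +
        ∑' k : ℤ, q ^ (n ^ 2 + n * k + k ^ 2 - n - k)) := by
  have hz : q ^ (n - 1) ≠ 0 := zpow_ne_zero _ hq0
  have h1 : q * q ^ (-n - 1) = q ^ (-n) := by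
    rw [← zpow_one_add₀ hq0]
    congr 1
    ring
  have h2 : q ^ 2 * q ^ (-n - 1) = (q ^ (n - 1))⁻¹ := by
    rw [← zpow_natCast, ← zpow_add₀ hq0, ← zpow_neg]
    congr 1
    push_cast
    ring
  rw [eulerSeries_eq_mul hq (q ^ (-n - 1)), h1, h2, mul_assoc (1 + _),
    mul_comm (eulerSeries q (q ^ (n - 1))⁻¹), eulerSeries_mul_eulerSeries_inv hq hz]
  have h3 : ∑' k : ℤ, q ^ (n ^ 2 + n * k + k ^ 2 - k)
      = q ^ (n ^ 2) * thetaSeries q (q ^ (n - 1)) := by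
    rw [thetaSeries, ← tsum_mul_left]
    refine tsum_congr fun k => ?_
    rw [← zpow_mul, ← zpow_add₀ hq0, ← zpow_add₀ hq0]
    congr 1
    ring
  have h4 : ∑' k : ℤ, q ^ (n ^ 2 + n * k + k ^ 2 - n - k)
      = q ^ (n ^ 2) * q ^ (-n) * thetaSeries q (q ^ (n - 1)) := by
    rw [thetaSeries, ← tsum_mul_left]
    refine tsum_congr fun k => ?_
    rw [← zpow_mul, ← zpow_add₀ hq0, ← zpow_add₀ hq0, ← zpow_add₀ hq0]
    congr 1
    ring
  rw [h3, h4]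
  ring

/-- A lattice automorphism moving the deep hole of `cubicTheta` to another one. -/
def hexagonalEquiv : ℤ × ℤ ≃ ℤ × ℤ where
  toFun x := (-x.1, x.1 + x.2)
  invFun x := (-x.1, x.1 + x.2)
  left_inv x := by simp
  right_inv x := by simp

lemma tsum_add_tsum_eq_cubicTheta {q : ℂ} (hq : ‖q‖ < 1) (hq0 : q ≠ 0) :
    ∑' n : ℤ, ((∑' k : ℤ, q ^ (n ^ 2 + n * k + k ^ 2 - k)) +
      ∑' k : ℤ, q ^ (n ^ 2 + n * k + k ^ 2 - n - k)) = 2 * cubicTheta q := by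
  have hc := summable_cubicTheta hq hq0
  have hrot : ∀ x : ℤ × ℤ, q ^ ((hexagonalEquiv x).1 ^ 2 +
      (hexagonalEquiv x).1 * (hexagonalEquiv x).2 + (hexagonalEquiv x).2 ^ 2 -
      (hexagonalEquiv x).2) = q ^ (x.1 ^ 2 + x.1 * x.2 + x.2 ^ 2 - x.1 - x.2) := by
    rintro ⟨n, k⟩
    simp only [hexagonalEquiv, Equiv.coe_fn_mk]
    congr 1
    ring
  have hc' : Summable fun x : ℤ × ℤ => q ^ (x.1 ^ 2 + x.1 * x.2 + x.2 ^ 2 - x.2) :=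
    hexagonalEquiv.summable_iff.mp (hc.congr fun x => (hrot x).symm)
  have hct : ∑' x : ℤ × ℤ, q ^ (x.1 ^ 2 + x.1 * x.2 + x.2 ^ 2 - x.2) = cubicTheta q := by
    rw [← hexagonalEquiv.tsum_eq, tsum_congr hrot, cubicTheta]
  rw [Summable.tsum_add hc'.prod hc.prod, two_mul]
  congr 1
  · rw [← hct, hc'.tsum_prod]
  · rw [cubicTheta, hc.tsum_prod]

lemma tsum_theta_mul_euler {q : ℂ} (hq : ‖q‖ < 1) (hq0 : q ≠ 0) (n : ℤ) :
    ∑' u : ℕ × ℕ, q ^ (n ^ 2) *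
      (q ^ (u.1 ^ 2) * (q ^ (-n - 1)) ^ u.1 / qPoch (q ^ 2) (q ^ 2) u.1 *
        (q ^ (u.2 ^ 2) * (q ^ (n - 1)) ^ u.2 / qPoch (q ^ 2) (q ^ 2) u.2)) =
      (qPochInf (q ^ 2) (q ^ 2))⁻¹ * ((∑' k : ℤ, q ^ (n ^ 2 + n * k + k ^ 2 - k)) +
        ∑' k : ℤ, q ^ (n ^ 2 + n * k + k ^ 2 - n - k)) := by
  rw [← theta_mul_eulerSeries hq hq0, tsum_mul_left, eulerSeries, eulerSeries,
    tsum_mul_tsum_of_summable_norm (summable_norm_eulerSeries hq _)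
      (summable_norm_eulerSeries hq _)]

lemma tsum_sextupleTerm {q : ℂ} (hq : ‖q‖ < 1) (hq0 : q ≠ 0) :
    ∑' n, sextupleTerm q n = 2 * cubicTheta q / qPochInf (q ^ 2) (q ^ 2) ^ 2 := by
  have hS := hasSum_quadrupleTerm hq hq0
  have hswap := Summable.tsum_comm (f := fun (u : ℕ × ℕ) (n : ℤ) => q ^ (n ^ 2) *
      (q ^ (u.1 ^ 2) * (q ^ (-n - 1)) ^ u.1 / qPoch (q ^ 2) (q ^ 2) u.1 *
        (q ^ (u.2 ^ 2) * (q ^ (n - 1)) ^ u.2 / qPoch (q ^ 2) (q ^ 2) u.2)))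
    (summable_theta_mul_euler hq hq0)
  rw [tsum_congr (tsum_theta_mul_euler hq hq0), tsum_mul_left,
    tsum_add_tsum_eq_cubicTheta hq hq0] at hswap
  rw [← hS.tsum_eq, hS.summable.tsum_prod, tsum_congr (tsum_quadrupleTerm_snd hq hq0),
    tsum_mul_left, ← hswap]
  ring

/-- $\sum_{N_1,\dots,N_6\ge0} q^{N^TG_4N-(N_1+N_3+N_4+N_6)}/\prod_i(q^2;q^2)_{N_i}
 = 6(q^3;q^3)_\infty^3/((q;q)_\infty(q^2;q^2)_\infty^2)$. -/
theorem G4_VOA1_2 (q : ℂ) (hq : ‖q‖ < 1) (hq0 : q ≠ 0) :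
    (∑' n : ℕ × ℕ × ℕ × ℕ × ℕ × ℕ,
        match n with
        | (n₁, n₂, n₃, n₄, n₅, n₆) =>
          q ^ ((Q4 n₁ n₂ n₃ n₄ n₅ n₆ : ℤ) - ((n₁ : ℤ) + n₃ + n₄ + n₆)) /
            (qPoch (q ^ 2) (q ^ 2) n₁ * qPoch (q ^ 2) (q ^ 2) n₂ *
              qPoch (q ^ 2) (q ^ 2) n₃ * qPoch (q ^ 2) (q ^ 2) n₄ *
              qPoch (q ^ 2) (q ^ 2) n₅ * qPoch (q ^ 2) (q ^ 2) n₆))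
      = 6 * qPochInf (q ^ 3) (q ^ 3) ^ 3 / (qPochInf q q * qPochInf (q ^ 2) (q ^ 2) ^ 2) := by
  have h1 := qPochInf_self_ne_zero hq
  have h2 := qPochInf_self_ne_zero (norm_sq_lt_one hq)
  refine (tsum_sextupleTerm hq hq0).trans ?_
  rw [div_eq_div_iff (pow_ne_zero 2 h2) (mul_ne_zero h1 (pow_ne_zero 2 h2))]
  linear_combination 2 * qPochInf (q ^ 2) (q ^ 2) ^ 2 * cubicTheta_mul_qPochInf hq hq0
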